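/- Let π : X → Y be a map with Y countable, and fix an injection idx : Y → ℕ. Define the learner that, on a sample (x₁,…,x_d) ∈ X^d, computes T := max_{1 ≤ j ≤ d} idx(π(x_j)), sets F := {y ∈ Y : idx(y) ≤ T}, and outputs π⁻¹(F). Then for every ε, δ ∈ (0,1) and every finitely supported probability distribution P on X, if d ≥ ln(1/δ) / (−ln(1−ε)), the probability under the i.i.d. product P^d that P(π⁻¹(F)) ≥ 1 − ε is at least 1 − δ; the output always lies in the family ℱ_fin^{(π)} = {π⁻¹(F) : F ⊆ Y finite}. -/

import Mathlib

open scoped ENNReal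

/-- The probability, under the i.i.d. product of `d` copies of `P`, of the event `E`
of `d`-tuples of samples. -/
noncomputable def iidProb {X : Type*} {d : ℕ} (P : PMF X) (E : Set (Fin d → X)) : ℝ≥0∞ :=
  ∑' s : Fin d → X, Set.indicator E (fun s => ∏ i, P (s i)) s

/-- The finite-precision finite-subset class `ℱ_fin^{(π)} = {π⁻¹(F) : F ⊆ Y finite}`. -/
def finPrecisionClass {X Y : Type*} (π : X → Y) : Set (Set X) :=
  {A : Set X | ∃ F : Finset Y, A = π ⁻¹' (F : Set Y)}

theorem ENNReal.tsum_prod_fin_eq_pow {X : Type*} (g : X → ℝ≥0∞) (d : ℕ) :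
    ∑' s : Fin d → X, ∏ i, g (s i) = (∑' x, g x) ^ d := by
  induction d with
  | zero => simp
  | succ d ih =>
    rw [← (Fin.consEquiv fun _ : Fin (d + 1) => X).tsum_eq, ENNReal.tsum_prod']
    simp only [Fin.consEquiv_apply, Fin.prod_univ_succ, Fin.cons_zero, Fin.cons_succ,
      ENNReal.tsum_mul_left, ih, ENNReal.tsum_mul_right]
    rw [pow_succ']

theorem iidProb_mono {X : Type*} {d : ℕ} (P : PMF X) {E E' : Set (Fin d → X)} (h : E ⊆ E') :
    iidProb P E ≤ iidProb P E' :=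
  ENNReal.tsum_le_tsum fun s => Set.indicator_le_indicator_of_subset h (fun _ => zero_le) s

theorem iidProb_add_compl {X : Type*} {d : ℕ} (P : PMF X) (E : Set (Fin d → X)) :
    iidProb P E + iidProb P Eᶜ = 1 := by
  unfold iidProb
  rw [← ENNReal.tsum_add]
  simp only [Set.indicator_self_add_compl_apply]
  rw [ENNReal.tsum_prod_fin_eq_pow, P.tsum_coe, one_pow]

theorem iidProb_forall_mem {X : Type*} {d : ℕ} (P : PMF X) (B : Set X) :
    iidProb P {S : Fin d → X | ∀ i, S i ∈ B} = P.toOuterMeasure B ^ d := by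
  classical
  rw [PMF.toOuterMeasure_apply, ← ENNReal.tsum_prod_fin_eq_pow]
  refine tsum_congr fun s => ?_
  simp only [Set.indicator_apply, Set.mem_ofPred_eq, Finset.prod_ite_zero, Finset.mem_univ,
    true_imp_iff]

/-- If `P` gives mass at most `q` to the set below a threshold `t`, then a sample of size `d`
reaches `t` with probability at least `1 - q ^ d`. -/
theorem one_sub_pow_le_iidProb_exists_le {X : Type*} {d : ℕ} (P : PMF X) (f : X → ℕ) (t : ℕ)
    {q : ℝ≥0∞} (hq : P.toOuterMeasure {x | f x < t} ≤ q) :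
    1 - q ^ d ≤ iidProb P {S : Fin d → X | ∃ i, t ≤ f (S i)} := by
  rw [tsub_le_iff_left, ← iidProb_add_compl P {S : Fin d → X | ∀ i, S i ∈ {x | f x < t}}]
  refine add_le_add ?_ (iidProb_mono P fun S hS => ?_)
  · rw [iidProb_forall_mem]
    gcongr
  · simpa using hS

/-- A finitely supported distribution has a `q`-quantile of any `ℕ`-valued function. -/
theorem PMF.exists_quantile {X : Type*} (P : PMF X) (hP : P.support.Finite) (f : X → ℕ)
    {q : ℝ≥0∞} (hq : q ≤ 1) :
    ∃ t, q ≤ P.toOuterMeasure {x | f x ≤ t} ∧ P.toOuterMeasure {x | f x < t} ≤ q := by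
  classical
  have hex : ∃ t, q ≤ P.toOuterMeasure {x | f x ≤ t} := by
    refine ⟨hP.toFinset.sup f, hq.trans_eq ?_⟩
    symm
    rw [PMF.toOuterMeasure_apply_eq_one_iff]
    exact fun x hx => Finset.le_sup (f := f) (hP.mem_toFinset.2 hx)
  refine ⟨Nat.find hex, Nat.find_spec hex, ?_⟩
  rcases h : Nat.find hex with _ | t
  · simp
  · have := Nat.find_min hex (m := t) (by omega)
    simpa only [Nat.lt_succ_iff] using (not_le.1 this).le

theorem one_sub_pow_le_of_log_div_le {ε δ : ℝ} (hε : ε ∈ Set.Ioo (0 : ℝ) 1)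
    (hδ : 0 < δ) {d : ℕ}
    (hd : Real.log (1 / δ) / (-Real.log (1 - ε)) ≤ (d : ℝ)) : (1 - ε) ^ d ≤ δ := by
  have hε' : 0 < 1 - ε := sub_pos.2 hε.2
  have hlog : Real.log (1 - ε) < 0 := Real.log_neg hε' (by linarith [hε.1])
  rw [div_le_iff₀ (by linarith), one_div, Real.log_inv] at hd
  rw [← Real.log_le_log_iff (pow_pos hε' d) hδ, Real.log_pow]
  linarith

/-- Explicit PL learner under finite precision: the quantile learner applied to the
discretized samples `π(x_j)` outputs `π⁻¹({y : idx y ≤ max_j idx (π (S j))})`, which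
always lies in `ℱ_fin^{(π)}`, and for every finitely supported `P` on `X` it captures
`P`-mass at least `1 - ε` with `P^d`-probability at least `1 - δ` whenever
`d ≥ ln(1/δ) / (-ln(1-ε))`. -/
theorem quantile_learner_coarse_grained {X Y : Type*} [Countable Y] (π : X → Y)
    (idx : Y → ℕ) (hidx : Function.Injective idx) (d : ℕ) :
    (∀ S : Fin d → X,
      π ⁻¹' {y : Y | idx y ≤ Finset.univ.sup fun j => idx (π (S j))}
        ∈ finPrecisionClass π) ∧
    (∀ ε δ : ℝ, ε ∈ Set.Ioo (0 : ℝ) 1 → δ ∈ Set.Ioo (0 : ℝ) 1 →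
      ∀ P : PMF X, P.support.Finite →
        Real.log (1 / δ) / (-Real.log (1 - ε)) ≤ (d : ℝ) →
          1 - ENNReal.ofReal δ ≤
            iidProb P {S : Fin d → X |
              1 - ENNReal.ofReal ε ≤
                P.toOuterMeasure
                  (π ⁻¹' {y : Y | idx y ≤ Finset.univ.sup fun j => idx (π (S j))})}) := by
  refine ⟨fun S => ?_, fun ε δ hε hδ P hP hd => ?_⟩
  · have hfin : {y : Y | idx y ≤ Finset.univ.sup fun j => idx (π (S j))}.Finite :=
      (Set.finite_Iic _).preimage hidx.injOn
    exact ⟨hfin.toFinset, by rw [hfin.coe_toFinset]⟩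
  · obtain ⟨t, ht, ht'⟩ := P.exists_quantile hP (fun x => idx (π x))
      (q := 1 - ENNReal.ofReal ε) tsub_le_self
    have hpow : (1 - ENNReal.ofReal ε) ^ d ≤ ENNReal.ofReal δ := by
      rw [← ENNReal.ofReal_one, ← ENNReal.ofReal_sub _ hε.1.le,
        ← ENNReal.ofReal_pow (sub_pos.2 hε.2).le]
      exact ENNReal.ofReal_le_ofReal (one_sub_pow_le_of_log_div_le hε hδ.1 hd)
    refine (tsub_le_tsub_left hpow 1).trans
      ((one_sub_pow_le_iidProb_exists_le P _ t ht').trans (iidProb_mono P ?_))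
    rintro S ⟨i, hi⟩
    refine ht.trans (P.toOuterMeasure.mono fun x hx => ?_)
    exact (le_trans hx hi).trans
      (Finset.le_sup (f := fun j => idx (π (S j))) (Finset.mem_univ i))
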